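/- Let J₆(x,y) = −1 + 2·Re(j₆(x+iy, x−iy)) with j₆(u,v) = (2−8b)u³ − b·u⁶ + 6uv + 6b·u⁴v − (9/2)u²v², b = exp(−iπ/3), and let f : ℝ⁴ → ℝ be f(x₀,x₁,x₂,x₃) = J₆(x₀,x₁) − J₆(x₂,x₃). Then the set {p ∈ ℝ⁴ : f(p) = 0 and ∇f(p) = 0} consists of exactly 283 points, and at each of these points the Hessian matrix of f is invertible; i.e. the affine three-fold f = 0 has exactly 283 real nodes (A₁-singularities). -/

import Mathlib

noncomputable section

/-- `bC = exp(-iπ/3)`. -/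
def bC : ℂ := Complex.exp (-((Real.pi : ℂ) / 3) * Complex.I)

/-- The polynomial `j6(u,v)`. -/
def j6 (u v : ℂ) : ℂ := (2 - 8*bC)*u^3 - bC*u^6 + 6*u*v + 6*bC*u^4*v - (9/2)*u^2*v^2

/-- The real folding-type polynomial `J6(x,y) = -1 + 2 Re(j6(x+iy, x-iy))`. -/
def J6R (x y : ℝ) : ℝ :=
  -1 + 2 * (j6 ((x : ℂ) + (y : ℂ) * Complex.I) ((x : ℂ) - (y : ℂ) * Complex.I)).re

/-- Partial derivative of `f` in the `i`-th coordinate direction. -/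
def pd {n : ℕ} (i : Fin n) (f : (Fin n → ℝ) → ℝ) (x : Fin n → ℝ) : ℝ :=
  deriv (fun t => f (Function.update x i t)) (x i)

/-- Hessian matrix of `f` at `x`. -/
def hessian {n : ℕ} (f : (Fin n → ℝ) → ℝ) (x : Fin n → ℝ) : Matrix (Fin n) (Fin n) ℝ :=
  Matrix.of fun i j => pd i (pd j f) x

def Jp (t x y : ℝ) : ℝ :=
  (-1)*x^6 + (-6)*x^5*y^1*t^1 + (6)*x^5 + (15)*x^4*y^2 + (18)*x^4*y^1*t^1 + (-9)*x^4 + (20)*x^3*y^3*t^1 + (-12)*x^3*y^2 + (-4)*x^3 + (-15)*x^2*y^4 + (12)*x^2*y^3*t^1 + (-18)*x^2*y^2 + (-24)*x^2*y^1*t^1 + (12)*x^2 + (-6)*x^1*y^5*t^1 + (-18)*x^1*y^4 + (12)*x^1*y^2 + (1)*y^6 + (-6)*y^5*t^1 + (-9)*y^4 + (8)*y^3*t^1 + (12)*y^2 + (-1)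

def Jxp (t x y : ℝ) : ℝ :=
  (-6)*x^5 + (-30)*x^4*y^1*t^1 + (30)*x^4 + (60)*x^3*y^2 + (72)*x^3*y^1*t^1 + (-36)*x^3 + (60)*x^2*y^3*t^1 + (-36)*x^2*y^2 + (-12)*x^2 + (-30)*x^1*y^4 + (24)*x^1*y^3*t^1 + (-36)*x^1*y^2 + (-48)*x^1*y^1*t^1 + (24)*x^1 + (-6)*y^5*t^1 + (-18)*y^4 + (12)*y^2

def Jyp (t x y : ℝ) : ℝ :=
  (-6)*x^5*t^1 + (30)*x^4*y^1 + (18)*x^4*t^1 + (60)*x^3*y^2*t^1 + (-24)*x^3*y^1 + (-60)*x^2*y^3 + (36)*x^2*y^2*t^1 + (-36)*x^2*y^1 + (-24)*x^2*t^1 + (-30)*x^1*y^4*t^1 + (-72)*x^1*y^3 + (24)*x^1*y^1 + (6)*y^5 + (-30)*y^4*t^1 + (-36)*y^3 + (24)*y^2*t^1 + (24)*y^1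

def Jxxp (t x y : ℝ) : ℝ :=
  (-30)*x^4 + (-120)*x^3*y^1*t^1 + (120)*x^3 + (180)*x^2*y^2 + (216)*x^2*y^1*t^1 + (-108)*x^2 + (120)*x^1*y^3*t^1 + (-72)*x^1*y^2 + (-24)*x^1 + (-30)*y^4 + (24)*y^3*t^1 + (-36)*y^2 + (-48)*y^1*t^1 + (24)

def Jxyp (t x y : ℝ) : ℝ :=
  (-30)*x^4*t^1 + (120)*x^3*y^1 + (72)*x^3*t^1 + (180)*x^2*y^2*t^1 + (-72)*x^2*y^1 + (-120)*x^1*y^3 + (72)*x^1*y^2*t^1 + (-72)*x^1*y^1 + (-48)*x^1*t^1 + (-30)*y^4*t^1 + (-72)*y^3 + (24)*y^1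

def Jyyp (t x y : ℝ) : ℝ :=
  (30)*x^4 + (120)*x^3*y^1*t^1 + (-24)*x^3 + (-180)*x^2*y^2 + (72)*x^2*y^1*t^1 + (-36)*x^2 + (-120)*x^1*y^3*t^1 + (-216)*x^1*y^2 + (24)*x^1 + (30)*y^4 + (-120)*y^3*t^1 + (-108)*y^2 + (48)*y^1*t^1 + (24)

theorem hd6 (c0 c1 c2 c3 c4 c5 c6 x : ℝ) :
    HasDerivAt (fun x : ℝ => c0 + c1*x + c2*x^2 + c3*x^3 + c4*x^4 + c5*x^5 + c6*x^6)
      (c1 + c2*(2*x) + c3*(3*x^2) + c4*(4*x^3) + c5*(5*x^4) + c6*(6*x^5)) x := by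
  have h1 := (hasDerivAt_id' x).const_mul c1
  have h2 := (hasDerivAt_pow 2 x).const_mul c2
  have h3 := (hasDerivAt_pow 3 x).const_mul c3
  have h4 := (hasDerivAt_pow 4 x).const_mul c4
  have h5 := (hasDerivAt_pow 5 x).const_mul c5
  have h6 := (hasDerivAt_pow 6 x).const_mul c6
  have h := (((((h1.const_add c0).add h2).add h3).add h4).add h5).add h6
  refine h.congr_deriv ?_
  push_cast
  ring

theorem hd_J_x (t x y : ℝ) : HasDerivAt (fun x => Jp t x y) (Jxp t x y) x := by
  have h := hd6 ((1)*y^6 + (-6)*y^5*t^1 + (-9)*y^4 + (8)*y^3*t^1 + (12)*y^2 + (-1)) ((-6)*y^5*t^1 + (-18)*y^4 + (12)*y^2) ((-15)*y^4 + (12)*y^3*t^1 + (-18)*y^2 + (-24)*y^1*t^1 + (12)) ((20)*y^3*t^1 + (-12)*y^2 + (-4)) ((15)*y^2 + (18)*y^1*t^1 + (-9)) ((-6)*y^1*t^1 + (6)) ((-1)) x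
  refine (h.congr_deriv ?_).congr_of_eventuallyEq (Filter.Eventually.of_forall fun z => ?_)
  · simp only [Jxp]; ring
  · simp only [Jp]; ring

theorem hd_J_y (t x y : ℝ) : HasDerivAt (fun y => Jp t x y) (Jyp t x y) y := by
  have h := hd6 ((-1)*x^6 + (6)*x^5 + (-9)*x^4 + (-4)*x^3 + (12)*x^2 + (-1)) ((-6)*x^5*t^1 + (18)*x^4*t^1 + (-24)*x^2*t^1) ((15)*x^4 + (-12)*x^3 + (-18)*x^2 + (12)*x^1 + (12)) ((20)*x^3*t^1 + (12)*x^2*t^1 + (8)*t^1) ((-15)*x^2 + (-18)*x^1 + (-9)) ((-6)*x^1*t^1 + (-6)*t^1) ((1)) y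
  refine (h.congr_deriv ?_).congr_of_eventuallyEq (Filter.Eventually.of_forall fun z => ?_)
  · simp only [Jyp]; ring
  · simp only [Jp]; ring

theorem hd_Jx_x (t x y : ℝ) : HasDerivAt (fun x => Jxp t x y) (Jxxp t x y) x := by
  have h := hd6 ((-6)*y^5*t^1 + (-18)*y^4 + (12)*y^2) ((-30)*y^4 + (24)*y^3*t^1 + (-36)*y^2 + (-48)*y^1*t^1 + (24)) ((60)*y^3*t^1 + (-36)*y^2 + (-12)) ((60)*y^2 + (72)*y^1*t^1 + (-36)) ((-30)*y^1*t^1 + (30)) ((-6)) (0) x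
  refine (h.congr_deriv ?_).congr_of_eventuallyEq (Filter.Eventually.of_forall fun z => ?_)
  · simp only [Jxxp]; ring
  · simp only [Jxp]; ring

theorem hd_Jx_y (t x y : ℝ) : HasDerivAt (fun y => Jxp t x y) (Jxyp t x y) y := by
  have h := hd6 ((-6)*x^5 + (30)*x^4 + (-36)*x^3 + (-12)*x^2 + (24)*x^1) ((-30)*x^4*t^1 + (72)*x^3*t^1 + (-48)*x^1*t^1) ((60)*x^3 + (-36)*x^2 + (-36)*x^1 + (12)) ((60)*x^2*t^1 + (24)*x^1*t^1) ((-30)*x^1 + (-18)) ((-6)*t^1) (0) y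
  refine (h.congr_deriv ?_).congr_of_eventuallyEq (Filter.Eventually.of_forall fun z => ?_)
  · simp only [Jxyp]; ring
  · simp only [Jxp]; ring

theorem hd_Jy_x (t x y : ℝ) : HasDerivAt (fun x => Jyp t x y) (Jxyp t x y) x := by
  have h := hd6 ((6)*y^5 + (-30)*y^4*t^1 + (-36)*y^3 + (24)*y^2*t^1 + (24)*y^1) ((-30)*y^4*t^1 + (-72)*y^3 + (24)*y^1) ((-60)*y^3 + (36)*y^2*t^1 + (-36)*y^1 + (-24)*t^1) ((60)*y^2*t^1 + (-24)*y^1) ((30)*y^1 + (18)*t^1) ((-6)*t^1) (0) x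
  refine (h.congr_deriv ?_).congr_of_eventuallyEq (Filter.Eventually.of_forall fun z => ?_)
  · simp only [Jxyp]; ring
  · simp only [Jyp]; ring

theorem hd_Jy_y (t x y : ℝ) : HasDerivAt (fun y => Jyp t x y) (Jyyp t x y) y := by
  have h := hd6 ((-6)*x^5*t^1 + (18)*x^4*t^1 + (-24)*x^2*t^1) ((30)*x^4 + (-24)*x^3 + (-36)*x^2 + (24)*x^1 + (24)) ((60)*x^3*t^1 + (36)*x^2*t^1 + (24)*t^1) ((-60)*x^2 + (-72)*x^1 + (-36)) ((-30)*x^1*t^1 + (-30)*t^1) ((6)) (0) y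
  refine (h.congr_deriv ?_).congr_of_eventuallyEq (Filter.Eventually.of_forall fun z => ?_)
  · simp only [Jyyp]; ring
  · simp only [Jyp]; ring

theorem J_inv (t x y p q s : ℝ) (hp : x^3-3*x*y^2 = p) (hq : 3*x^2*y-y^3 = q) (hs : x^2+y^2 = s) :
    Jp t x y = -1 - 4*p - 8*t*q - (p^2-q^2) - 2*t*p*q + 12*s + 6*s*(p+t*q) - 9*s^2 := by
  subst hp hq hs; simp only [Jp]; ring

theorem E1_inv (t x y p q s : ℝ) (hp : x^3-3*x*y^2 = p) (hq : 3*x^2*y-y^3 = q) (hs : x^2+y^2 = s) :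
    x * Jxp t x y + y * Jyp t x y =
      6 * (-2*p - 4*t*q - (p^2-q^2) - 2*t*p*q + 4*s - 6*s^2 + 5*s*(p+t*q)) := by
  subst hp hq hs; simp only [Jxp, Jyp]; ring

theorem E2_inv (t x y p q s : ℝ) (hp : x^3-3*x*y^2 = p) (hq : 3*x^2*y-y^3 = q) (hs : x^2+y^2 = s) :
    y * Jxp t x y - x * Jyp t x y =
      6 * (4*t*p - 2*q - 2*p*q + t*(p^2-q^2) + 3*s*(q-t*p)) := by
  subst hp hq hs; simp only [Jxp, Jyp]; ring

theorem H_inv (t x y p q s : ℝ) (hp : x^3-3*x*y^2 = p) (hq : 3*x^2*y-y^3 = q) (hs : x^2+y^2 = s) :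
    Jxxp t x y * Jyyp t x y - Jxyp t x y ^ 2 =
      4*(12+24*(p+t*q)-36*s)^2
        - 4*(s*((-12-15*(p+t*q)+36*s)^2+(24*t-15*(q-t*p)-36*t*s)^2)+324*s^2
          -36*(p*(-12-15*(p+t*q)+36*s)-q*(24*t-15*(q-t*p)-36*t*s))) := by
  subst hp hq hs; simp only [Jxxp, Jxyp, Jyyp]; ring

theorem elim_s (t p q s : ℝ) (ht : t^2 = 3) (l1 : -8*p*q+2*t*p*(1+s)-14*q+18*s*q+4*t*s-6*t*s^2 = 0)
    (l2 : 4*(p^2-q^2)+14*p*(1-s)+2*t*q*(1-s)-4*s+6*s^2 = 0) (l3 : p^2+q^2-s^3 = 0) :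
    s^2*((s-1)*((s-4)*((s^2-4*s+1)*(s^2-8*s+13)))) = 0 := by
  have e : s^2*((s-1)*((s-4)*((s^2-4*s+1)*(s^2-8*s+13)))) =
     ((-1/2)*p^1*q^1*s^2 + (-9/8)*q^1*s^3 + (-1/8)*t*p^1*s^3 + (-5/8)*t*s^4 + (-3/8)*t*p^1*s^2 + (53/8)*q^1*s^2 + (13/4)*t*s^3 + (13/2)*p^1*q^1 + (-99/8)*q^1*s^1 + (29/8)*t*p^1*s^1 + (-35/8)*t*s^2 + (-13/8)*t*p^1 + (91/8)*q^1 + (13/4)*t*s^1) * (-8*p*q+2*t*p*(1+s)-14*q+18*s*q+4*t*s-6*t*s^2)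
     + ((-1/2)*q^2*s^2 + (1/4)*s^5 + (7/8)*p^1*s^3 + (1/8)*t*q^1*s^3 + (-11/8)*s^4 + (-53/8)*p^1*s^2 + (-3/8)*t*q^1*s^2 + (3/2)*s^3 + (13/2)*q^2 + (125/8)*p^1*s^1 + (3/8)*t*q^1*s^1 + (11/8)*s^2 + (-91/8)*p^1 + (-13/8)*t*q^1 + (-13/4)*s^1) * (4*(p^2-q^2)+14*p*(1-s)+2*t*q*(1-s)-4*s+6*s^2)
     + ((-2)*q^2*s^2 + (-1)*s^5 + (-7/2)*p^1*s^3 + (-1/2)*t*q^1*s^3 + (37/2)*s^4 + (53/2)*p^1*s^2 + (-1/2)*t*q^1*s^2 + (-108)*s^3 + (26)*q^2 + (-125/2)*p^1*s^1 + (29/2)*t*q^1*s^1 + (573/2)*s^2 + (91/2)*p^1 + (-39/2)*t*q^1 + (-377)*s^1 + (169)) * (p^2+q^2-s^3) := by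
    clear l1 l2 l3; grind
  rw [e, l1, l2, l3]; ring

theorem solve_1 (t p q s : ℝ) (ht : t^2 = 3) (hs : s = (4 + (0)*t)) (l1 : -8*p*q+2*t*p*(1+s)-14*q+18*s*q+4*t*s-6*t*s^2 = 0)
    (l2 : 4*(p^2-q^2)+14*p*(1-s)+2*t*q*(1-s)-4*s+6*s^2 = 0) (l3 : p^2+q^2-s^3 = 0) :
    p = (8 + (0)*t) ∧ q = (0 + (0)*t) := by
  have ep : p - (8 + (0)*t) =
     ((-1/288)*t*p^1 + (-1/72)*t + (-1/288)*q^1) * (-8*p*q+2*t*p*(1+s)-14*q+18*s*q+4*t*s-6*t*s^2)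
     + ((-1/288)*t*q^1 + (1/72) + (1/288)*p^1) * (4*(p^2-q^2)+14*p*(1-s)+2*t*q*(1-s)-4*s+6*s^2)
     + ((-1/72)*t*q^1 + (7/36) + (-1/72)*p^1) * (p^2+q^2-s^3) := by
    subst hs
    clear l1 l2 l3; grind
  rw [l1, l2, l3] at ep
  have eq : q - (0 + (0)*t) =
     ((-1/288)*t*q^1 + (-1/8) + (-5/96)*p^1) * (-8*p*q+2*t*p*(1+s)-14*q+18*s*q+4*t*s-6*t*s^2)
     + ((1/288)*t*p^1 + (7/72)*t + (-5/96)*q^1) * (4*(p^2-q^2)+14*p*(1-s)+2*t*q*(1-s)-4*s+6*s^2)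
     + ((-1/72)*t*p^1 + (5/18)*t + (-5/24)*q^1) * (p^2+q^2-s^3) := by
    subst hs
    clear l1 l2 l3; grind
  rw [l1, l2, l3] at eq
  constructor <;> linarith

theorem solve_2 (t p q s : ℝ) (ht : t^2 = 3) (hs : s = (2 + (-1)*t)) (l1 : -8*p*q+2*t*p*(1+s)-14*q+18*s*q+4*t*s-6*t*s^2 = 0)
    (l2 : 4*(p^2-q^2)+14*p*(1-s)+2*t*q*(1-s)-4*s+6*s^2 = 0) (l3 : p^2+q^2-s^3 = 0) :
    p = (7/2 + (-2)*t) ∧ q = (1 + (-1/2)*t) := by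
  have ep : p - (7/2 + (-2)*t) =
     (((-1/32)+(-1/32)*t)*p^1 + (1/16) + ((5/32)+(3/32)*t)*q^1) * (-8*p*q+2*t*p*(1+s)-14*q+18*s*q+4*t*s-6*t*s^2)
     + (((-1/32)+(-1/32)*t)*q^1 + (1/16) + ((-5/32)+(-3/32)*t)*p^1) * (4*(p^2-q^2)+14*p*(1-s)+2*t*q*(1-s)-4*s+6*s^2)
     + (((-1/8)+(-1/8)*t)*q^1 + ((15/8)+(7/8)*t) + ((5/8)+(3/8)*t)*p^1) * (p^2+q^2-s^3) := by
    subst hs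
    clear l1 l2 l3; grind
  rw [l1, l2, l3] at ep
  have eq : q - (1 + (-1/2)*t) =
     (((-1/32)+(-1/32)*t)*q^1 + ((-1/4)+(5/48)*t) + ((-9/32)+(-5/96)*t)*p^1) * (-8*p*q+2*t*p*(1+s)-14*q+18*s*q+4*t*s-6*t*s^2)
     + (((1/32)+(1/32)*t)*p^1 + ((-1/4)+(3/16)*t) + ((-9/32)+(-5/96)*t)*q^1) * (4*(p^2-q^2)+14*p*(1-s)+2*t*q*(1-s)-4*s+6*s^2)
     + (((-1/8)+(-1/8)*t)*p^1 + ((-5/8)+(5/8)*t) + ((-9/8)+(-5/24)*t)*q^1) * (p^2+q^2-s^3) := by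
    subst hs
    clear l1 l2 l3; grind
  rw [l1, l2, l3] at eq
  constructor <;> linarith

theorem solve_4 (t p q s : ℝ) (ht : t^2 = 3) (hs : s = (4 + (-1)*t)) (l1 : -8*p*q+2*t*p*(1+s)-14*q+18*s*q+4*t*s-6*t*s^2 = 0)
    (l2 : 4*(p^2-q^2)+14*p*(1-s)+2*t*q*(1-s)-4*s+6*s^2 = 0) (l3 : p^2+q^2-s^3 = 0) :
    p = (17/2 + (-3)*t) ∧ q = (0 + (1/2)*t) := by
  have ep : p - (17/2 + (-3)*t) =
     (((27/5408)+(43/16224)*t)*p^1 + ((-1/208)+(-1/156)*t) + ((-119/16224)+(-59/16224)*t)*q^1) * (-8*p*q+2*t*p*(1+s)-14*q+18*s*q+4*t*s-6*t*s^2)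
     + (((27/5408)+(43/16224)*t)*q^1 + ((-11/624)+(-1/104)*t) + ((119/16224)+(59/16224)*t)*p^1) * (4*(p^2-q^2)+14*p*(1-s)+2*t*q*(1-s)-4*s+6*s^2)
     + (((27/1352)+(43/4056)*t)*q^1 + ((55/312)+(17/312)*t) + ((-119/4056)+(-59/4056)*t)*p^1) * (p^2+q^2-s^3) := by
    subst hs
    clear l1 l2 l3; grind
  rw [l1, l2, l3] at ep
  have eq : q - (0 + (1/2)*t) =
     (((27/5408)+(43/16224)*t)*q^1 + ((1/26)+(19/624)*t) + ((161/5408)+(319/16224)*t)*p^1) * (-8*p*q+2*t*p*(1+s)-14*q+18*s*q+4*t*s-6*t*s^2)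
     + (((-27/5408)+(-43/16224)*t)*p^1 + ((-7/104)+(-17/624)*t) + ((161/5408)+(319/16224)*t)*q^1) * (4*(p^2-q^2)+14*p*(1-s)+2*t*q*(1-s)-4*s+6*s^2)
     + (((27/1352)+(43/4056)*t)*p^1 + ((-25/104)+(-35/312)*t) + ((161/1352)+(319/4056)*t)*q^1) * (p^2+q^2-s^3) := by
    subst hs
    clear l1 l2 l3; grind
  rw [l1, l2, l3] at eq
  constructor <;> linarith

theorem solve_5 (t p q s : ℝ) (ht : t^2 = 3) (hs : s = (2 + (1)*t)) (l1 : -8*p*q+2*t*p*(1+s)-14*q+18*s*q+4*t*s-6*t*s^2 = 0)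
    (l2 : 4*(p^2-q^2)+14*p*(1-s)+2*t*q*(1-s)-4*s+6*s^2 = 0) (l3 : p^2+q^2-s^3 = 0) :
    p = (7/2 + (2)*t) ∧ q = (-1 + (-1/2)*t) := by
  have ep : p - (7/2 + (2)*t) =
     (((1/32)+(-1/32)*t)*p^1 + (-1/16) + ((5/32)+(-3/32)*t)*q^1) * (-8*p*q+2*t*p*(1+s)-14*q+18*s*q+4*t*s-6*t*s^2)
     + (((1/32)+(-1/32)*t)*q^1 + (1/16) + ((-5/32)+(3/32)*t)*p^1) * (4*(p^2-q^2)+14*p*(1-s)+2*t*q*(1-s)-4*s+6*s^2)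
     + (((1/8)+(-1/8)*t)*q^1 + ((15/8)+(-7/8)*t) + ((5/8)+(-3/8)*t)*p^1) * (p^2+q^2-s^3) := by
    subst hs
    clear l1 l2 l3; grind
  rw [l1, l2, l3] at ep
  have eq : q - (-1 + (-1/2)*t) =
     (((1/32)+(-1/32)*t)*q^1 + ((-1/4)+(-5/48)*t) + ((-9/32)+(5/96)*t)*p^1) * (-8*p*q+2*t*p*(1+s)-14*q+18*s*q+4*t*s-6*t*s^2)
     + (((-1/32)+(1/32)*t)*p^1 + ((1/4)+(3/16)*t) + ((-9/32)+(5/96)*t)*q^1) * (4*(p^2-q^2)+14*p*(1-s)+2*t*q*(1-s)-4*s+6*s^2)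
     + (((1/8)+(-1/8)*t)*p^1 + ((5/8)+(5/8)*t) + ((-9/8)+(5/24)*t)*q^1) * (p^2+q^2-s^3) := by
    subst hs
    clear l1 l2 l3; grind
  rw [l1, l2, l3] at eq
  constructor <;> linarith

theorem solve_6 (t p q s : ℝ) (ht : t^2 = 3) (hs : s = (4 + (1)*t)) (l1 : -8*p*q+2*t*p*(1+s)-14*q+18*s*q+4*t*s-6*t*s^2 = 0)
    (l2 : 4*(p^2-q^2)+14*p*(1-s)+2*t*q*(1-s)-4*s+6*s^2 = 0) (l3 : p^2+q^2-s^3 = 0) :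
    p = (17/2 + (3)*t) ∧ q = (0 + (1/2)*t) := by
  have ep : p - (17/2 + (3)*t) =
     (((-27/5408)+(43/16224)*t)*p^1 + ((1/208)+(-1/156)*t) + ((-119/16224)+(59/16224)*t)*q^1) * (-8*p*q+2*t*p*(1+s)-14*q+18*s*q+4*t*s-6*t*s^2)
     + (((-27/5408)+(43/16224)*t)*q^1 + ((-11/624)+(1/104)*t) + ((119/16224)+(-59/16224)*t)*p^1) * (4*(p^2-q^2)+14*p*(1-s)+2*t*q*(1-s)-4*s+6*s^2)
     + (((-27/1352)+(43/4056)*t)*q^1 + ((55/312)+(-17/312)*t) + ((-119/4056)+(59/4056)*t)*p^1) * (p^2+q^2-s^3) := by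
    subst hs
    clear l1 l2 l3; grind
  rw [l1, l2, l3] at ep
  have eq : q - (0 + (1/2)*t) =
     (((-27/5408)+(43/16224)*t)*q^1 + ((1/26)+(-19/624)*t) + ((161/5408)+(-319/16224)*t)*p^1) * (-8*p*q+2*t*p*(1+s)-14*q+18*s*q+4*t*s-6*t*s^2)
     + (((27/5408)+(-43/16224)*t)*p^1 + ((7/104)+(-17/624)*t) + ((161/5408)+(-319/16224)*t)*q^1) * (4*(p^2-q^2)+14*p*(1-s)+2*t*q*(1-s)-4*s+6*s^2)
     + (((-27/1352)+(43/4056)*t)*p^1 + ((25/104)+(-35/312)*t) + ((161/1352)+(-319/4056)*t)*q^1) * (p^2+q^2-s^3) := by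
    subst hs
    clear l1 l2 l3; grind
  rw [l1, l2, l3] at eq
  constructor <;> linarith

theorem b_eq : bC = ⟨1/2, -(√3/2)⟩ := by
  unfold bC
  have : (-((Real.pi : ℂ) / 3) * Complex.I) = ((-(Real.pi/3) : ℝ) : ℂ) * Complex.I := by
    push_cast; ring
  rw [this]
  apply Complex.ext
  · rw [Complex.exp_ofReal_mul_I_re, Real.cos_neg, Real.cos_pi_div_three]
  · rw [Complex.exp_ofReal_mul_I_im, Real.sin_neg, Real.sin_pi_div_three]

theorem J6R_eq (x y : ℝ) : J6R x y = Jp √3 x y := by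
  unfold J6R j6
  have e : (2 - 8*bC) = (⟨-2, 4*√3⟩ : ℂ) := by
    rw [b_eq]; apply Complex.ext <;> simp <;> ring
  have e2 : ((9:ℂ)/2) = ((9/2 : ℝ) : ℂ) := by push_cast; ring
  rw [e, b_eq, e2]
  simp only [Jp]
  simp [pow_succ]
  ring

theorem forward (t x y p q : ℝ) (ht : t^2 = 3) (hp : x^3-3*x*y^2 = p) (hq : 3*x^2*y-y^3 = q)
    (hx : Jxp t x y = 0) (hy : Jyp t x y = 0) :
    (x = 0 ∧ y = 0) ∨ (p = 1/2 ∧ q = t/2) ∨ (p = 8 ∧ q = 0) ∨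
    (p = 7/2 - 2*t ∧ q = 1 - t/2) ∨ (p = -1/2 ∧ q = t/2) ∨ (p = 17/2 - 3*t ∧ q = t/2) ∨
    (p = 7/2 + 2*t ∧ q = -1 - t/2) ∨ (p = 17/2 + 3*t ∧ q = t/2) ∨ (p = 1/2 ∧ q = -(t/2)) := by
  obtain ⟨s, hs⟩ : ∃ s, x^2+y^2 = s := ⟨_, rfl⟩
  have e1 := E1_inv t x y p q s hp hq hs
  have e2 := E2_inv t x y p q s hp hq hs
  rw [hx, hy] at e1 e2
  have l3 : p^2+q^2-s^3 = 0 := by subst hp hq hs; ring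
  have l1 : -8*p*q+2*t*p*(1+s)-14*q+18*s*q+4*t*s-6*t*s^2 = 0 := by
    linear_combination (-1/6)*e2 - t/6*e1 - (-4*q - 2*p*q + 5*s*q)*ht
  have l2 : 4*(p^2-q^2)+14*p*(1-s)+2*t*q*(1-s)-4*s+6*s^2 = 0 := by
    linear_combination (-t/6)*e2 + e1/6 - (4*p + (p^2-q^2) - 3*s*p)*ht
  have h := elim_s t p q s ht l1 l2 l3
  rcases mul_eq_zero.1 h with h | h
  · left
    have hs0 : s = 0 := by simpa using h
    constructor <;> nlinarith [sq_nonneg x, sq_nonneg y]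
  right
  rcases mul_eq_zero.1 h with h | h
  · have hs1 : s = 1 := by linarith
    subst hs1
    have hpp : (p - 1/2) * (p + 1/2) = 0 := by linear_combination l2/8 + l3/2
    have hqq : (q - t/2) * (q + t/2) = 0 := by linear_combination -l2/8 + l3/2 - ht/4
    have hpq : (p - 1/2) * (q - t/2) = 0 := by linear_combination -l1/8
    rcases mul_eq_zero.1 hpq with h1 | h1
    · rcases mul_eq_zero.1 hqq with h2 | h2
      · left; constructor <;> linarith
      · iterate 7 right
        constructor <;> linarith
    · rcases mul_eq_zero.1 hpp with h2 | h2
      · left; constructor <;> linarith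
      · right; right; right; left; constructor <;> linarith
  rcases mul_eq_zero.1 h with h | h
  · have := solve_1 t p q s ht (by linarith) l1 l2 l3
    right; left; constructor <;> linarith
  rcases mul_eq_zero.1 h with h | h
  · have h' : (s - (2 - t)) * (s - (2 + t)) = 0 := by linear_combination h - ht
    rcases mul_eq_zero.1 h' with h | h
    · have := solve_2 t p q s ht (by linarith) l1 l2 l3
      right; right; left; constructor <;> linarith
    · have := solve_5 t p q s ht (by linarith) l1 l2 l3
      iterate 5 right
      left; constructor <;> linarith
  · have h' : (s - (4 - t)) * (s - (4 + t)) = 0 := by linear_combination h - ht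
    rcases mul_eq_zero.1 h' with h | h
    · have := solve_4 t p q s ht (by linarith) l1 l2 l3
      iterate 4 right
      left; constructor <;> linarith
    · have := solve_6 t p q s ht (by linarith) l1 l2 l3
      iterate 6 right
      left; constructor <;> linarith

/-- A critical point with value `v` and nondegenerate Hessian. -/
def Good (t x y v : ℝ) : Prop :=
  Jxp t x y = 0 ∧ Jyp t x y = 0 ∧ Jp t x y = v ∧ Jxxp t x y * Jyyp t x y - Jxyp t x y ^ 2 ≠ 0

theorem backward (t x y p q s v : ℝ) (hp : x^3-3*x*y^2 = p) (hq : 3*x^2*y-y^3 = q)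
    (hs : s^3 = p^2+q^2) (hs0 : s ≠ 0)
    (h1 : 6 * (-2*p - 4*t*q - (p^2-q^2) - 2*t*p*q + 4*s - 6*s^2 + 5*s*(p+t*q)) = 0)
    (h2 : 6 * (4*t*p - 2*q - 2*p*q + t*(p^2-q^2) + 3*s*(q-t*p)) = 0)
    (h3 : -1 - 4*p - 8*t*q - (p^2-q^2) - 2*t*p*q + 12*s + 6*s*(p+t*q) - 9*s^2 = v)
    (h4 : 4*(12+24*(p+t*q)-36*s)^2
        - 4*(s*((-12-15*(p+t*q)+36*s)^2+(24*t-15*(q-t*p)-36*t*s)^2)+324*s^2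
          -36*(p*(-12-15*(p+t*q)+36*s)-q*(24*t-15*(q-t*p)-36*t*s))) ≠ 0) :
    Good t x y v := by
  have hss : x^2+y^2 = s := by
    have : (x^2+y^2)^3 = s^3 := by rw [hs, ← hp, ← hq]; ring
    exact (Odd.strictMono_pow (R := ℝ) (n := 3) (by decide)).injective this
  have e1 := E1_inv t x y p q s hp hq hss
  have e2 := E2_inv t x y p q s hp hq hss
  rw [h1] at e1
  rw [h2] at e2
  refine ⟨?_, ?_, ?_, ?_⟩
  · have : s * Jxp t x y = 0 := by rw [← hss]; linear_combination x * e1 + y * e2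
    exact (mul_eq_zero.1 this).resolve_left hs0
  · have : s * Jyp t x y = 0 := by rw [← hss]; linear_combination y * e1 - x * e2
    exact (mul_eq_zero.1 this).resolve_left hs0
  · rw [J_inv t x y p q s hp hq hss, h3]
  · rwa [H_inv t x y p q s hp hq hss]

theorem good0 (t : ℝ) : Good t 0 0 (-1) := by
  refine ⟨?_, ?_, ?_, ?_⟩ <;> norm_num [Jxp, Jyp, Jp, Jxxp, Jxyp, Jyyp]

theorem good1 (t x y : ℝ) (ht : t^2 = 3) (hb : 1 < t) (hb' : t < 19/10)
    (hp : x^3-3*x*y^2 = 1/2) (hq : 3*x^2*y-y^3 = t/2) : Good t x y (-1) := by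
  refine backward t x y _ _ (1) (-1) hp hq ?_ (by linarith) ?_ ?_ ?_ ?_
  · clear hp hq; grind
  · clear hp hq; grind
  · clear hp hq; grind
  · clear hp hq; grind
  · refine ne_of_eq_of_ne (b := 1296) ?_ (by intro h; linarith)
    clear hp hq; grind

theorem good2 (t x y : ℝ) (ht : t^2 = 3) (hb : 1 < t) (hb' : t < 19/10)
    (hp : x^3-3*x*y^2 = 8) (hq : 3*x^2*y-y^3 = 0) : Good t x y (-1) := by
  refine backward t x y _ _ (4) (-1) hp hq ?_ (by linarith) ?_ ?_ ?_ ?_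
  · clear hp hq; grind
  · clear hp hq; grind
  · clear hp hq; grind
  · clear hp hq; grind
  · refine ne_of_eq_of_ne (b := 5184) ?_ (by intro h; linarith)
    clear hp hq; grind

theorem good3 (t x y : ℝ) (ht : t^2 = 3) (hb : 1 < t) (hb' : t < 19/10)
    (hp : x^3-3*x*y^2 = 7/2 - 2*t) (hq : 3*x^2*y-y^3 = 1 - t/2) : Good t x y (0) := by
  refine backward t x y _ _ (2-t) (0) hp hq ?_ (by linarith) ?_ ?_ ?_ ?_
  · clear hp hq; grind
  · clear hp hq; grind
  · clear hp hq; grind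
  · clear hp hq; grind
  · refine ne_of_eq_of_ne (b := -6912+3456*t) ?_ (by intro h; linarith)
    clear hp hq; grind

theorem good4 (t x y : ℝ) (ht : t^2 = 3) (hb : 1 < t) (hb' : t < 19/10)
    (hp : x^3-3*x*y^2 = -1/2) (hq : 3*x^2*y-y^3 = t/2) : Good t x y (0) := by
  refine backward t x y _ _ (1) (0) hp hq ?_ (by linarith) ?_ ?_ ?_ ?_
  · clear hp hq; grind
  · clear hp hq; grind
  · clear hp hq; grind
  · clear hp hq; grind
  · refine ne_of_eq_of_ne (b := -5184) ?_ (by intro h; linarith)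
    clear hp hq; grind

theorem good5 (t x y : ℝ) (ht : t^2 = 3) (hb : 1 < t) (hb' : t < 19/10)
    (hp : x^3-3*x*y^2 = 17/2 - 3*t) (hq : 3*x^2*y-y^3 = t/2) : Good t x y (0) := by
  refine backward t x y _ _ (4-t) (0) hp hq ?_ (by linarith) ?_ ?_ ?_ ?_
  · clear hp hq; grind
  · clear hp hq; grind
  · clear hp hq; grind
  · clear hp hq; grind
  · refine ne_of_eq_of_ne (b := -20736+10368*t) ?_ (by intro h; linarith)
    clear hp hq; grind

theorem good6 (t x y : ℝ) (ht : t^2 = 3) (hb : 1 < t) (hb' : t < 19/10)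
    (hp : x^3-3*x*y^2 = 7/2 + 2*t) (hq : 3*x^2*y-y^3 = -1 - t/2) : Good t x y (0) := by
  refine backward t x y _ _ (2+t) (0) hp hq ?_ (by linarith) ?_ ?_ ?_ ?_
  · clear hp hq; grind
  · clear hp hq; grind
  · clear hp hq; grind
  · clear hp hq; grind
  · refine ne_of_eq_of_ne (b := -6912-3456*t) ?_ (by intro h; linarith)
    clear hp hq; grind

theorem good7 (t x y : ℝ) (ht : t^2 = 3) (hb : 1 < t) (hb' : t < 19/10)
    (hp : x^3-3*x*y^2 = 17/2 + 3*t) (hq : 3*x^2*y-y^3 = t/2) : Good t x y (0) := by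
  refine backward t x y _ _ (4+t) (0) hp hq ?_ (by linarith) ?_ ?_ ?_ ?_
  · clear hp hq; grind
  · clear hp hq; grind
  · clear hp hq; grind
  · clear hp hq; grind
  · refine ne_of_eq_of_ne (b := -20736-10368*t) ?_ (by intro h; linarith)
    clear hp hq; grind

theorem good8 (t x y : ℝ) (ht : t^2 = 3) (hb : 1 < t) (hb' : t < 19/10)
    (hp : x^3-3*x*y^2 = 1/2) (hq : 3*x^2*y-y^3 = -(t/2)) : Good t x y (8) := by
  refine backward t x y _ _ (1) (8) hp hq ?_ (by linarith) ?_ ?_ ?_ ?_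
  · clear hp hq; grind
  · clear hp hq; grind
  · clear hp hq; grind
  · clear hp hq; grind
  · refine ne_of_eq_of_ne (b := 5184) ?_ (by intro h; linarith)
    clear hp hq; grind

/-- Cube roots of a complex number. -/
def S3 (c : ℂ) : Finset ℂ := (Polynomial.nthRoots 3 c).toFinset

theorem mem_S3 (c z : ℂ) : z ∈ S3 c ↔ z^3 = c := by
  simp [S3, Polynomial.mem_nthRoots]

theorem card_S3 (c : ℂ) (hc : c ≠ 0) : (S3 c).card = 3 := by
  have h := Complex.isPrimitiveRoot_exp 3 (by norm_num)
  obtain ⟨w, hw⟩ := IsAlgClosed.exists_pow_nat_eq c (n := 3) (by norm_num)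
  rw [S3, Multiset.toFinset_card_of_nodup (h.nthRoots_nodup hc), h.card_nthRoots, if_pos ⟨w, hw⟩]

theorem card_bU (l : Finset ℂ) (hl : ∀ c ∈ l, c ≠ 0) : (l.biUnion S3).card = 3 * l.card := by
  rw [Finset.card_biUnion, Finset.sum_congr rfl fun c hc => card_S3 c (hl c hc)]
  · simp [mul_comm]
  · intro a _ b _ hab
    rw [Function.onFun, Finset.disjoint_left]
    intro z hz hz'
    rw [mem_S3] at hz hz'
    exact hab (hz.symm.trans hz')

theorem cube_eq (x y p q : ℝ) :
    ((⟨x, y⟩ : ℂ)^3 = ⟨p, q⟩) ↔ (x^3-3*x*y^2 = p ∧ 3*x^2*y-y^3 = q) := by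
  rw [Complex.ext_iff]
  simp only [pow_succ, pow_zero, one_mul, Complex.mul_re, Complex.mul_im]
  constructor
  · rintro ⟨h1, h2⟩
    constructor <;> [rw [← h1]; rw [← h2]] <;> ring
  · rintro ⟨h1, h2⟩
    constructor <;> [rw [← h1]; rw [← h2]] <;> ring

def lA (t : ℝ) : Finset ℂ := {⟨1/2, t/2⟩, ⟨8, 0⟩}
def lB (t : ℝ) : Finset ℂ :=
  {⟨7/2 - 2*t, 1 - t/2⟩, ⟨-1/2, t/2⟩, ⟨17/2 - 3*t, t/2⟩, ⟨7/2 + 2*t, -1 - t/2⟩, ⟨17/2 + 3*t, t/2⟩}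
def lD (t : ℝ) : Finset ℂ := {⟨1/2, -(t/2)⟩}

theorem card_lA (t : ℝ) : (lA t).card = 2 := by
  unfold lA
  rw [Finset.card_insert_of_notMem, Finset.card_singleton]
  rw [Finset.mem_singleton, Complex.mk.injEq]
  rintro ⟨h, _⟩
  norm_num at h

theorem card_lB (t : ℝ) (hb : 17/10 < t) (hb' : t < 19/10) : (lB t).card = 5 := by
  unfold lB
  rw [Finset.card_insert_of_notMem, Finset.card_insert_of_notMem, Finset.card_insert_of_notMem,
    Finset.card_insert_of_notMem, Finset.card_singleton]
  all_goals
    simp only [Finset.mem_insert, Finset.mem_singleton, Complex.mk.injEq, not_or, not_and_or]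
  · left; intro h; linarith
  · constructor <;> left <;> intro h <;> linarith
  · refine ⟨?_, ?_, ?_⟩ <;> left <;> intro h <;> linarith
  · refine ⟨?_, ?_, ?_, ?_⟩
    · right; intro h; linarith
    all_goals left; intro h; linarith

def fA (t : ℝ) : Finset ℂ := insert 0 ((lA t).biUnion S3)
def fB (t : ℝ) : Finset ℂ := (lB t).biUnion S3
def fD (t : ℝ) : Finset ℂ := (lD t).biUnion S3

theorem card_fA (t : ℝ) : (fA t).card = 7 := by
  have h0 : ∀ c ∈ lA t, c ≠ 0 := by
    intro c hc h
    simp only [lA, Finset.mem_insert, Finset.mem_singleton] at hc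
    subst h
    rcases hc with h | h <;> have := congrArg Complex.re h <;> norm_num at this
  rw [fA, Finset.card_insert_of_notMem, card_bU _ h0, card_lA]
  rw [Finset.mem_biUnion]
  rintro ⟨c, hc, h⟩
  rw [mem_S3] at h
  exact h0 c hc (by rw [← h]; norm_num)

theorem card_fB (t : ℝ) (hb : 17/10 < t) (hb' : t < 19/10) : (fB t).card = 15 := by
  rw [fB, card_bU, card_lB t hb hb']
  intro c hc h
  simp only [lB, Finset.mem_insert, Finset.mem_singleton] at hc
  subst h
  rcases hc with h | h | h | h | h <;>
    have := congrArg Complex.im h <;> simp only [Complex.zero_im] at this <;> linarith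

theorem card_fD (t : ℝ) : (fD t).card = 3 := by
  rw [fD, card_bU, lD, Finset.card_singleton]
  intro c hc h
  simp only [lD, Finset.mem_singleton] at hc
  subst h
  have := congrArg Complex.re hc
  norm_num at this

theorem mem_fA (t x y : ℝ) (ht : t^2 = 3) (hb : 17/10 < t) (hb' : t < 19/10)
    (h : (⟨x, y⟩ : ℂ) ∈ fA t) : Good t x y (-1) := by
  simp only [fA, lA, Finset.mem_insert, Finset.mem_biUnion, Finset.mem_singleton,
    exists_eq_or_imp, exists_eq_left, mem_S3, cube_eq] at h
  rcases h with h | h | h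
  · have h1 := congrArg Complex.re h
    have h2 := congrArg Complex.im h
    simp only [Complex.zero_re, Complex.zero_im] at h1 h2
    rw [h1, h2]
    exact good0 t
  · exact good1 t x y ht (by linarith) hb' h.1 h.2
  · exact good2 t x y ht (by linarith) hb' h.1 h.2

theorem mem_fB (t x y : ℝ) (ht : t^2 = 3) (hb : 17/10 < t) (hb' : t < 19/10)
    (h : (⟨x, y⟩ : ℂ) ∈ fB t) : Good t x y 0 := by
  simp only [fB, lB, Finset.mem_insert, Finset.mem_biUnion, Finset.mem_singleton,
    exists_eq_or_imp, exists_eq_left, mem_S3, cube_eq] at h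
  rcases h with h | h | h | h | h
  · exact good3 t x y ht (by linarith) hb' h.1 h.2
  · exact good4 t x y ht (by linarith) hb' h.1 h.2
  · exact good5 t x y ht (by linarith) hb' h.1 h.2
  · exact good6 t x y ht (by linarith) hb' h.1 h.2
  · exact good7 t x y ht (by linarith) hb' h.1 h.2

theorem mem_fD (t x y : ℝ) (ht : t^2 = 3) (hb : 17/10 < t) (hb' : t < 19/10)
    (h : (⟨x, y⟩ : ℂ) ∈ fD t) : Good t x y 8 := by
  simp only [fD, lD, Finset.mem_biUnion, Finset.mem_singleton,
    exists_eq_left, mem_S3, cube_eq] at h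
  exact good8 t x y ht (by linarith) hb' h.1 h.2

theorem crit_mem (t x y : ℝ) (ht : t^2 = 3) (hx : Jxp t x y = 0) (hy : Jyp t x y = 0) :
    (⟨x, y⟩ : ℂ) ∈ fA t ∨ (⟨x, y⟩ : ℂ) ∈ fB t ∨ (⟨x, y⟩ : ℂ) ∈ fD t := by
  simp only [fA, fB, fD, lA, lB, lD, Finset.mem_insert, Finset.mem_biUnion, Finset.mem_singleton,
    exists_eq_or_imp, exists_eq_left, mem_S3, cube_eq]
  have h := forward t x y _ _ ht rfl rfl hx hy
  have h0 : (x = 0 ∧ y = 0) → (⟨x, y⟩ : ℂ) = 0 := by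
    rintro ⟨rfl, rfl⟩; rfl
  rcases h with h | h | h | h | h | h | h | h | h
  · exact Or.inl (Or.inl (h0 h))
  · exact Or.inl (Or.inr (Or.inl h))
  · exact Or.inl (Or.inr (Or.inr h))
  · exact Or.inr (Or.inl (Or.inl h))
  · exact Or.inr (Or.inl (Or.inr (Or.inl h)))
  · exact Or.inr (Or.inl (Or.inr (Or.inr (Or.inl h))))
  · exact Or.inr (Or.inl (Or.inr (Or.inr (Or.inr (Or.inl h)))))
  · exact Or.inr (Or.inl (Or.inr (Or.inr (Or.inr (Or.inr h)))))
  · exact Or.inr (Or.inr h)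

theorem pd_f (f : (Fin 4 → ℝ) → ℝ) (hf : ∀ p, f p = Jp √3 (p 0) (p 1) - Jp √3 (p 2) (p 3)) :
    pd 0 f = (fun p => Jxp √3 (p 0) (p 1)) ∧ pd 1 f = (fun p => Jyp √3 (p 0) (p 1)) ∧
    pd 2 f = (fun p => -Jxp √3 (p 2) (p 3)) ∧ pd 3 f = (fun p => -Jyp √3 (p 2) (p 3)) := by
  refine ⟨?_, ?_, ?_, ?_⟩ <;> funext p <;> simp only [pd, hf]
  · simpa [Function.update] using ((hd_J_x √3 (p 0) (p 1)).sub_const (Jp √3 (p 2) (p 3))).deriv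
  · simpa [Function.update] using ((hd_J_y √3 (p 0) (p 1)).sub_const (Jp √3 (p 2) (p 3))).deriv
  · simpa [Function.update] using ((hd_J_x √3 (p 2) (p 3)).const_sub (Jp √3 (p 0) (p 1))).deriv
  · simpa [Function.update] using ((hd_J_y √3 (p 2) (p 3)).const_sub (Jp √3 (p 0) (p 1))).deriv

theorem hess_f (f : (Fin 4 → ℝ) → ℝ) (hf : ∀ p, f p = Jp √3 (p 0) (p 1) - Jp √3 (p 2) (p 3))
    (p : Fin 4 → ℝ) : hessian f p =
      !![Jxxp √3 (p 0) (p 1), Jxyp √3 (p 0) (p 1), 0, 0;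
         Jxyp √3 (p 0) (p 1), Jyyp √3 (p 0) (p 1), 0, 0;
         0, 0, -Jxxp √3 (p 2) (p 3), -Jxyp √3 (p 2) (p 3);
         0, 0, -Jxyp √3 (p 2) (p 3), -Jyyp √3 (p 2) (p 3)] := by
  obtain ⟨h0, h1, h2, h3⟩ := pd_f f hf
  have a1 := (hd_Jx_x √3 (p 0) (p 1)).deriv
  have a2 := (hd_Jx_y √3 (p 0) (p 1)).deriv
  have a3 := (hd_Jy_x √3 (p 0) (p 1)).deriv
  have a4 := (hd_Jy_y √3 (p 0) (p 1)).deriv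
  have b1 := (hd_Jx_x √3 (p 2) (p 3)).neg.deriv
  have b2 := (hd_Jx_y √3 (p 2) (p 3)).neg.deriv
  have b3 := (hd_Jy_x √3 (p 2) (p 3)).neg.deriv
  have b4 := (hd_Jy_y √3 (p 2) (p 3)).neg.deriv
  ext i j
  fin_cases i <;> fin_cases j <;>
    simp [hessian, h0, h1, h2, h3] <;> simp [pd, Function.update] <;> first | assumption | simpa using b1 | simpa using b2 | simpa using b3 | simpa using b4

theorem hess_det (f : (Fin 4 → ℝ) → ℝ) (hf : ∀ p, f p = Jp √3 (p 0) (p 1) - Jp √3 (p 2) (p 3))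
    (p : Fin 4 → ℝ) : (hessian f p).det =
      (Jxxp √3 (p 0) (p 1) * Jyyp √3 (p 0) (p 1) - Jxyp √3 (p 0) (p 1) ^ 2) *
      (Jxxp √3 (p 2) (p 3) * Jyyp √3 (p 2) (p 3) - Jxyp √3 (p 2) (p 3) ^ 2) := by
  rw [hess_f f hf]
  simp [Matrix.det_succ_row_zero, Fin.sum_univ_succ, Fin.succAbove]
  ring

/-- Pairs of critical points with equal critical value. -/
def KK (t : ℝ) : Finset (ℂ × ℂ) := fA t ×ˢ fA t ∪ fB t ×ˢ fB t ∪ fD t ×ˢ fD t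

def toR4 (z : ℂ × ℂ) : Fin 4 → ℝ := ![z.1.re, z.1.im, z.2.re, z.2.im]

theorem toR4_inj : Function.Injective toR4 := by
  intro a b h
  have h0 := congrFun h 0
  have h1 := congrFun h 1
  have h2 := congrFun h 2
  have h3 := congrFun h 3
  simp [toR4] at h0 h1 h2 h3
  exact Prod.ext (Complex.ext h0 h1) (Complex.ext h2 h3)

theorem card_KK (t : ℝ) (ht : t^2 = 3) (hb : 17/10 < t) (hb' : t < 19/10) :
    (KK t).card = 283 := by
  have dAB : Disjoint (fA t) (fB t) := by
    rw [Finset.disjoint_left]; intro z h1 h2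
    have := (mem_fA t z.re z.im ht hb hb' h1).2.2.1
    have := (mem_fB t z.re z.im ht hb hb' h2).2.2.1
    linarith
  have dAD : Disjoint (fA t) (fD t) := by
    rw [Finset.disjoint_left]; intro z h1 h2
    have := (mem_fA t z.re z.im ht hb hb' h1).2.2.1
    have := (mem_fD t z.re z.im ht hb hb' h2).2.2.1
    linarith
  have dBD : Disjoint (fB t) (fD t) := by
    rw [Finset.disjoint_left]; intro z h1 h2
    have := (mem_fB t z.re z.im ht hb hb' h1).2.2.1
    have := (mem_fD t z.re z.im ht hb hb' h2).2.2.1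
    linarith
  rw [KK, Finset.card_union_of_disjoint, Finset.card_union_of_disjoint]
  · simp only [Finset.card_product, card_fA, card_fB t hb hb', card_fD]
  · exact Finset.disjoint_product.2 (Or.inl dAB)
  · rw [Finset.disjoint_union_left]
    exact ⟨Finset.disjoint_product.2 (Or.inl dAD), Finset.disjoint_product.2 (Or.inl dBD)⟩

theorem mem_KK (t x y z w : ℝ) (ht : t^2 = 3) (hb : 17/10 < t) (hb' : t < 19/10) :
    ((⟨x, y⟩, ⟨z, w⟩) : ℂ × ℂ) ∈ KK t ↔ (Jp t x y - Jp t z w = 0 ∧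
      Jxp t x y = 0 ∧ Jyp t x y = 0 ∧ Jxp t z w = 0 ∧ Jyp t z w = 0) := by
  simp only [KK, Finset.mem_union, Finset.mem_product]
  constructor
  · rintro ((⟨h1, h2⟩ | ⟨h1, h2⟩) | ⟨h1, h2⟩)
    · have a := mem_fA t x y ht hb hb' h1
      have b := mem_fA t z w ht hb hb' h2
      exact ⟨by rw [a.2.2.1, b.2.2.1]; ring, a.1, a.2.1, b.1, b.2.1⟩
    · have a := mem_fB t x y ht hb hb' h1
      have b := mem_fB t z w ht hb hb' h2
      exact ⟨by rw [a.2.2.1, b.2.2.1]; ring, a.1, a.2.1, b.1, b.2.1⟩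
    · have a := mem_fD t x y ht hb hb' h1
      have b := mem_fD t z w ht hb hb' h2
      exact ⟨by rw [a.2.2.1, b.2.2.1]; ring, a.1, a.2.1, b.1, b.2.1⟩
  · rintro ⟨h, h1, h2, h3, h4⟩
    rcases crit_mem t x y ht h1 h2 with a | a | a <;>
    rcases crit_mem t z w ht h3 h4 with b | b | b
    · exact Or.inl (Or.inl ⟨a, b⟩)
    · have a := (mem_fA t x y ht hb hb' a).2.2.1
      have b := (mem_fB t z w ht hb hb' b).2.2.1
      linarith
    · have a := (mem_fA t x y ht hb hb' a).2.2.1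
      have b := (mem_fD t z w ht hb hb' b).2.2.1
      linarith
    · have a := (mem_fB t x y ht hb hb' a).2.2.1
      have b := (mem_fA t z w ht hb hb' b).2.2.1
      linarith
    · exact Or.inl (Or.inr ⟨a, b⟩)
    · have a := (mem_fB t x y ht hb hb' a).2.2.1
      have b := (mem_fD t z w ht hb hb' b).2.2.1
      linarith
    · have a := (mem_fD t x y ht hb hb' a).2.2.1
      have b := (mem_fA t z w ht hb hb' b).2.2.1
      linarith
    · have a := (mem_fD t x y ht hb hb' a).2.2.1
      have b := (mem_fB t z w ht hb hb' b).2.2.1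
      linarith
    · exact Or.inr ⟨a, b⟩

theorem hess_ne (t x y : ℝ) (ht : t^2 = 3) (hb : 17/10 < t) (hb' : t < 19/10)
    (h1 : Jxp t x y = 0) (h2 : Jyp t x y = 0) :
    Jxxp t x y * Jyyp t x y - Jxyp t x y ^ 2 ≠ 0 := by
  rcases crit_mem t x y ht h1 h2 with a | a | a
  · exact (mem_fA t x y ht hb hb' a).2.2.2
  · exact (mem_fB t x y ht hb hb' a).2.2.2
  · exact (mem_fD t x y ht hb hb' a).2.2.2

/-- The affine three-fold `J6(x₀,x₁) - J6(x₂,x₃) = 0` in `ℝ⁴` has exactly 283 real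
singular points, all of them nodes (the Hessian is invertible there). -/
theorem stmt (f : (Fin 4 → ℝ) → ℝ)
    (hf : ∀ p, f p = J6R (p 0) (p 1) - J6R (p 2) (p 3)) :
    {p : Fin 4 → ℝ | f p = 0 ∧ ∀ i, pd i f p = 0}.Finite ∧
    {p : Fin 4 → ℝ | f p = 0 ∧ ∀ i, pd i f p = 0}.ncard = 283 ∧
    ∀ p : Fin 4 → ℝ, f p = 0 → (∀ i, pd i f p = 0) → (hessian f p).det ≠ 0 := by
  have hf' : ∀ p, f p = Jp √3 (p 0) (p 1) - Jp √3 (p 2) (p 3) := by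
    intro p; rw [hf, J6R_eq, J6R_eq]
  have ht : √3 ^ 2 = (3 : ℝ) := Real.sq_sqrt (by norm_num)
  have hpos : 0 ≤ √(3 : ℝ) := Real.sqrt_nonneg 3
  have hb : 17/10 < √(3 : ℝ) := by nlinarith
  have hb' : √(3 : ℝ) < 19/10 := by nlinarith
  obtain ⟨h0, h1, h2, h3⟩ := pd_f f hf'
  have hcrit : ∀ p : Fin 4 → ℝ, (∀ i, pd i f p = 0) ↔
      (Jxp √3 (p 0) (p 1) = 0 ∧ Jyp √3 (p 0) (p 1) = 0 ∧
        Jxp √3 (p 2) (p 3) = 0 ∧ Jyp √3 (p 2) (p 3) = 0) := by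
    intro p
    simp [Fin.forall_fin_succ, h0, h1, h2, h3]
  have hset : {p : Fin 4 → ℝ | f p = 0 ∧ ∀ i, pd i f p = 0} = toR4 '' (KK √3 : Set (ℂ × ℂ)) := by
    ext p
    rw [Set.mem_ofPred_eq, hcrit, hf', ← mem_KK √3 _ _ _ _ ht hb hb', Set.mem_image]
    constructor
    · intro h
      refine ⟨_, h, ?_⟩
      ext i
      fin_cases i <;> rfl
    · rintro ⟨a, ha, rfl⟩
      exact ha
  refine ⟨?_, ?_, ?_⟩
  · rw [hset]
    exact (Finset.finite_toSet _).image _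
  · rw [hset, Set.ncard_image_of_injective _ toR4_inj, Set.ncard_coe_finset,
      card_KK √3 ht hb hb']
  · intro p _ hp
    rw [hcrit] at hp
    rw [hess_det f hf']
    exact mul_ne_zero (hess_ne _ _ _ ht hb hb' hp.1 hp.2.1)
      (hess_ne _ _ _ ht hb hb' hp.2.2.1 hp.2.2.2)
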